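/- arXiv:2103.09932 — 2 statements merged into one kernel-verified Lean document; each statement's English description precedes it below -/
import Mathlib

section
/- Let V be a subspace of ℝ^{2n} equipped with the standard symplectic form σ, and let L ⊆ V be a totally isotropic subspace that is maximal among totally isotropic subspaces contained in V. Then there exist a totally isotropic subspace L'' with V = L ⊕ L'', a basis (v_1,…,v_m) of L (m = dim L), and a basis (v̄_1,…,v̄_q) of L'' (q = dim L'' ≤ m), such that σ(v_i, v̄_j) = 0 whenever i ≠ j and σ(v_j, v̄_j) ≠ 0 for every j ∈ {1,…,q}. -/
open scoped BigOperators

namespace EntTrim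

/-- The standard symplectic form on `ℝ^(2m)`:
`σ(v, w) = Σ_{i=1}^m (v_{2i-1} * w_{2i} - v_{2i} * w_{2i-1})` (zero-based indexing). -/
def stdSymp (m : ℕ) (v w : Fin (2 * m) → ℝ) : ℝ :=
  ∑ i : Fin m,
    (v ⟨2 * (i : ℕ), by have := i.isLt; omega⟩ *
        w ⟨2 * (i : ℕ) + 1, by have := i.isLt; omega⟩ -
      v ⟨2 * (i : ℕ) + 1, by have := i.isLt; omega⟩ *
        w ⟨2 * (i : ℕ), by have := i.isLt; omega⟩)

open Module in
/-- A linearly independent family of functionals is the initial part of a dual basis. -/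
theorem exists_basis_dual_to_linearIndependent {K L : Type*} [Field K] [AddCommGroup L]
    [Module K L] [FiniteDimensional K L] {q : ℕ} {φ : Fin q → Dual K L}
    (hφ : LinearIndependent K φ) :
    q ≤ finrank K L ∧ ∃ b : Basis (Fin (finrank K L)) K L,
      ∀ i j, φ j (b i) = if (i : ℕ) = j then 1 else 0 := by
  classical
  have hq : q ≤ finrank K L := by
    simpa [Subspace.dual_finrank_eq] using hφ.fintype_card_le_finrank
  refine ⟨hq, ?_⟩
  let e := Basis.sumExtend hφ
  have : Finite (Fin q ⊕ Basis.sumExtendIndex hφ) := Module.Finite.finite_basis e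
  have : Finite (Basis.sumExtendIndex hφ) := Finite.of_injective _ (Sum.inr_injective (α := Fin q))
  have hcard : q + Nat.card (Basis.sumExtendIndex hφ) = finrank K L := by
    rw [← Subspace.dual_finrank_eq, finrank_eq_nat_card_basis e]
    simp [Nat.card_sum]
  let r : Fin q ⊕ Basis.sumExtendIndex hφ ≃ Fin (finrank K L) :=
    ((Equiv.sumCongr (Equiv.refl _) (Finite.equivFin _)).trans finSumFinEquiv).trans
      (finCongr hcard)
  have hr (j : Fin q) : r (Sum.inl j) = Fin.castLE hq j := by
    ext
    rfl
  let d := e.reindex r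
  have hd (j : Fin q) : d (Fin.castLE hq j) = φ j := by
    rw [← hr]
    simp [d, e, Basis.sumExtend]
    rfl
  refine ⟨d.dualBasis.map (evalEquiv K L).symm, fun i j => ?_⟩
  rw [← hd, Basis.map_apply, apply_evalEquiv_symm_apply, Basis.dualBasis_apply_self]
  simp [Fin.ext_iff, eq_comm]

/-- Every subspace `V` is the sum of a maximal isotropic subspace `L` and the span of a family
which is dual to the initial part of a basis of `L`. -/
theorem exists_dual_family_of_maximal_isotropic {K E : Type*} [Field K] [AddCommGroup E]
    [Module K E] [FiniteDimensional K E] {B : LinearMap.BilinForm K E} (hB : B.IsAlt)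
    {V L : Submodule K E} (hLV : L ≤ V) (hiso : ∀ u ∈ L, ∀ v ∈ L, B u v = 0)
    (hmax : ∀ L' : Submodule K E, L' ≤ V → (∀ u ∈ L', ∀ v ∈ L', B u v = 0) → L ≤ L' → L' = L) :
    ∃ q : ℕ, q ≤ Module.finrank K L ∧
      ∃ (b : Module.Basis (Fin (Module.finrank K L)) K L) (c : Fin q → E),
        L ⊔ Submodule.span K (Set.range c) = V ∧
        ∀ i j, B (b i) (c j) = if (i : ℕ) = j then 1 else 0 := by
  obtain ⟨D, hD⟩ := L.exists_isCompl
  let C := D ⊓ V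
  have hsup : L ⊔ C = V := by
    rw [← sup_inf_assoc_of_le D hLV, hD.sup_eq_top, top_inf_eq]
  let g : C →ₗ[K] Module.Dual K L := L.subtype.dualMap ∘ₗ B.flip ∘ₗ C.subtype
  have hg : LinearMap.ker g = ⊥ := by
    rw [LinearMap.ker_eq_bot']
    intro x hx
    have hxL (l : E) (hl : l ∈ L) : B l x = 0 := LinearMap.congr_fun hx ⟨l, hl⟩
    have hLx : L ⊔ K ∙ (x : E) = L := by
      refine hmax _ (sup_le hLV ?_) ?_ le_sup_left
      · simpa using x.2.2
      · intro u hu v hv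
        obtain ⟨l, hl, y, hy, rfl⟩ := Submodule.mem_sup.1 hu
        obtain ⟨a, rfl⟩ := Submodule.mem_span_singleton.1 hy
        obtain ⟨l', hl', z, hz, rfl⟩ := Submodule.mem_sup.1 hv
        obtain ⟨a', rfl⟩ := Submodule.mem_span_singleton.1 hz
        have hxl : B x l' = 0 := by rw [← hB.neg_eq, hxL l' hl', neg_zero]
        simp [hiso l hl l' hl', hxL l hl, hxl, hB.self_eq_zero]
    have hmem : (x : E) ∈ L := by
      rw [← hLx]
      exact Submodule.mem_sup_right (Submodule.mem_span_singleton_self _)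
    exact Subtype.ext (Submodule.disjoint_def.1 hD.disjoint _ hmem x.2.1)
  let e := Module.finBasis K C
  obtain ⟨hq, b, hb⟩ := exists_basis_dual_to_linearIndependent (e.linearIndependent.map' g hg)
  refine ⟨_, hq, b, fun j => e j, ?_, hb⟩
  have hspan : Submodule.span K (Set.range fun j => (e j : E)) = C := by
    have := congrArg (Submodule.map C.subtype) e.span_eq
    rwa [Submodule.map_span, ← Set.range_comp, Submodule.map_top, Submodule.range_subtype] at this
  rw [hspan, hsup]

/-- A family dual to the initial part of a family in an isotropic subspace `L` can be made
isotropic by adding elements of `L`, keeping it dual. -/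
theorem exists_isotropic_dual_family {K E : Type*} [Field K] [NeZero (2 : K)] [AddCommGroup E]
    [Module K E] {B : LinearMap.BilinForm K E} (hB : B.IsAlt) {L : Submodule K E}
    (hiso : ∀ u ∈ L, ∀ v ∈ L, B u v = 0) {m q : ℕ} (hqm : q ≤ m) {v : Fin m → E}
    (hv : ∀ i, v i ∈ L) {c : Fin q → E}
    (hvc : ∀ i j, B (v i) (c j) = if (i : ℕ) = j then 1 else 0) :
    ∃ w : Fin q → E, (∀ j, w j - c j ∈ L) ∧ (∀ i j, B (w i) (w j) = 0) ∧
      ∀ i j, B (v i) (w j) = if (i : ℕ) = j then 1 else 0 := by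
  let s (j : Fin q) : E := ∑ k, (-(B (c j) (c k) / 2)) • v (Fin.castLE hqm k)
  have hs (j : Fin q) : s j ∈ L := L.sum_mem fun k _ => L.smul_mem _ (hv _)
  have hsc (i j : Fin q) : B (s i) (c j) = -(B (c i) (c j) / 2) := by
    simp [s, hvc, ← Fin.ext_iff]
  refine ⟨fun j => c j + s j, fun j => by simpa using hs j, fun i j => ?_, fun i j => ?_⟩
  · have hcs : B (c i) (s j) = B (c j) (c i) / 2 := by
      rw [← hB.neg_eq, hsc, neg_neg]
    have h2 : (2 : K) ≠ 0 := two_ne_zero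
    simp only [map_add, LinearMap.add_apply, hsc, hcs, hiso _ (hs i) _ (hs j)]
    rw [← hB.neg_eq (c i) (c j)]
    field_simp
    ring
  · simp [hvc, hiso _ (hv i) _ (hs j)]

/-- The standard symplectic form as a bilinear form. -/
def stdSympForm (n : ℕ) : LinearMap.BilinForm ℝ (Fin (2 * n) → ℝ) :=
  LinearMap.mk₂ ℝ (stdSymp n)
    (fun u v w => by
      simp only [stdSymp, Pi.add_apply, ← Finset.sum_add_distrib]
      exact Finset.sum_congr rfl fun _ _ => by ring)
    (fun a u v => by
      simp only [stdSymp, Pi.smul_apply, smul_eq_mul, Finset.mul_sum]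
      exact Finset.sum_congr rfl fun _ _ => by ring)
    (fun u v w => by
      simp only [stdSymp, Pi.add_apply, ← Finset.sum_add_distrib]
      exact Finset.sum_congr rfl fun _ _ => by ring)
    (fun a u v => by
      simp only [stdSymp, Pi.smul_apply, smul_eq_mul, Finset.mul_sum]
      exact Finset.sum_congr rfl fun _ _ => by ring)

theorem stdSympForm_isAlt (n : ℕ) : (stdSympForm n).IsAlt := fun v => by
  change stdSymp n v v = 0
  exact Finset.sum_eq_zero fun _ _ => by ring

/-- For a maximal totally isotropic subspace `L` of a subspace `V ⊆ ℝ^(2n)`, there is a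
totally isotropic complement `L''` of `L` in `V` together with bases `(v_i)` of `L` and
`(v̄_j)` of `L''` such that `σ(v_i, v̄_j) = 0` for `i ≠ j` and `σ(v_j, v̄_j) ≠ 0`. -/
theorem maximal_isotropic_pairing (n : ℕ) (V L : Submodule ℝ (Fin (2 * n) → ℝ))
    (hLV : L ≤ V)
    (hiso : ∀ u ∈ L, ∀ v ∈ L, stdSymp n u v = 0)
    (hmax : ∀ L' : Submodule ℝ (Fin (2 * n) → ℝ), L' ≤ V →
      (∀ u ∈ L', ∀ v ∈ L', stdSymp n u v = 0) → L ≤ L' → L' = L) :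
    ∃ L'' : Submodule ℝ (Fin (2 * n) → ℝ),
      (∀ u ∈ L'', ∀ v ∈ L'', stdSymp n u v = 0) ∧ L ⊓ L'' = ⊥ ∧ L ⊔ L'' = V ∧
      ∃ (m q : ℕ) (hm : m = Module.finrank ℝ L) (hq : q = Module.finrank ℝ L'')
        (hqm : q ≤ m) (v : Fin m → (Fin (2 * n) → ℝ)) (vb : Fin q → (Fin (2 * n) → ℝ)),
        LinearIndependent ℝ v ∧ Submodule.span ℝ (Set.range v) = L ∧
        LinearIndependent ℝ vb ∧ Submodule.span ℝ (Set.range vb) = L'' ∧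
        (∀ (i : Fin m) (j : Fin q), (i : ℕ) ≠ (j : ℕ) → stdSymp n (v i) (vb j) = 0) ∧
        (∀ j : Fin q, stdSymp n (v (Fin.castLE hqm j)) (vb j) ≠ 0) := by
  have hB := stdSympForm_isAlt n
  obtain ⟨q, hqm, b, c, hV, hbc⟩ := exists_dual_family_of_maximal_isotropic hB hLV hiso hmax
  obtain ⟨w, hwc, hww, hbw⟩ :=
    exists_isotropic_dual_family hB hiso hqm (v := fun i => (b i : Fin (2 * n) → ℝ))
      (fun i => (b i).2) hbc
  have hcoef (d : Fin q → ℝ) (hd : ∑ j, d j • w j ∈ L) (j : Fin q) : d j = 0 := by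
    have h : stdSympForm n (b (Fin.castLE hqm j)) (∑ j, d j • w j) = 0 :=
      hiso _ (b (Fin.castLE hqm j)).2 _ hd
    simpa [hbw, ← Fin.ext_iff] using h
  have hw : LinearIndependent ℝ w :=
    Fintype.linearIndependent_iff.2 fun d hd => hcoef d (hd ▸ L.zero_mem)
  refine ⟨Submodule.span ℝ (Set.range w), ?_, ?_, ?_, Module.finrank ℝ L, q, rfl, ?_, hqm,
    fun i => b i, w, ?_, ?_, hw, rfl, ?_, ?_⟩
  · intro u hu v hv
    obtain ⟨x, rfl⟩ := (Submodule.mem_span_range_iff_exists_fun ℝ).1 hu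
    obtain ⟨y, rfl⟩ := (Submodule.mem_span_range_iff_exists_fun ℝ).1 hv
    change stdSympForm n _ _ = 0
    simp [hww]
  · rw [Submodule.eq_bot_iff]
    rintro x ⟨hxL, hxw⟩
    obtain ⟨d, rfl⟩ := (Submodule.mem_span_range_iff_exists_fun ℝ).1 hxw
    simp [hcoef d hxL]
  · rw [← hV]
    refine le_antisymm (sup_le le_sup_left ?_) (sup_le le_sup_left ?_) <;>
      rw [Submodule.span_le, Set.range_subset_iff] <;> intro j
    · rw [← sub_add_cancel (w j) (c j)]
      exact Submodule.add_mem_sup (hwc j) (Submodule.subset_span ⟨j, rfl⟩)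
    · rw [← sub_add_cancel (c j) (w j), ← neg_sub]
      exact Submodule.add_mem_sup (L.neg_mem (hwc j)) (Submodule.subset_span ⟨j, rfl⟩)
  · simp [finrank_span_eq_card hw]
  · exact b.linearIndependent.map' L.subtype L.ker_subtype
  · have := congrArg (Submodule.map L.subtype) b.span_eq
    rwa [Submodule.map_span, ← Set.range_comp, Submodule.map_top, Submodule.range_subtype] at this
  · intro i j hij
    exact (hbw i j).trans (if_neg hij)
  · intro j h
    exact one_ne_zero (((hbw (Fin.castLE hqm j) j).trans (if_pos rfl)).symm.trans h)

end EntTrim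
end

section
/- Let p be a prime number and let L be a Lagrangian subspace of V = (ZMod p)^{2n_A} × (ZMod p)^{2n_B} with the product symplectic form. Then the radical of σ_A restricted to π_A(L) equals L_A, i.e., {u ∈ π_A(L) : σ_A(u, w) = 0 for all w ∈ π_A(L)} = L_A (the center of the projection of the correlated stabilizer subgroup onto one party is trivial). -/
open scoped BigOperators

namespace EntTrim

/-- The standard symplectic form on `(ZMod p)^(2m)`:
`σ(v, w) = Σ_{i=1}^m (v_{2i-1} * w_{2i} - v_{2i} * w_{2i-1})` (zero-based indexing). -/
def stdSympF (p m : ℕ) (v w : Fin (2 * m) → ZMod p) : ZMod p :=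
  ∑ i : Fin m,
    (v ⟨2 * (i : ℕ), by have := i.isLt; omega⟩ *
        w ⟨2 * (i : ℕ) + 1, by have := i.isLt; omega⟩ -
      v ⟨2 * (i : ℕ) + 1, by have := i.isLt; omega⟩ *
        w ⟨2 * (i : ℕ), by have := i.isLt; omega⟩)

/-- The product symplectic form on `(ZMod p)^(2nA) × (ZMod p)^(2nB)`. -/
def prodSympF (p nA nB : ℕ) (u w : (Fin (2 * nA) → ZMod p) × (Fin (2 * nB) → ZMod p)) :
    ZMod p :=
  stdSympF p nA u.1 w.1 + stdSympF p nB u.2 w.2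

theorem stdSympF_self (p m : ℕ) (v : Fin (2 * m) → ZMod p) : stdSympF p m v v = 0 :=
  Finset.sum_eq_zero fun _ _ => by ring

theorem stdSympF_zero_left (p m : ℕ) (w : Fin (2 * m) → ZMod p) : stdSympF p m 0 w = 0 := by
  simp [stdSympF]

theorem stdSympF_zero_right (p m : ℕ) (v : Fin (2 * m) → ZMod p) : stdSympF p m v 0 = 0 := by
  simp [stdSympF]

theorem stdSympF_swap (p m : ℕ) (v w : Fin (2 * m) → ZMod p) :
    stdSympF p m v w = -stdSympF p m w v := by
  unfold stdSympF
  rw [← Finset.sum_neg_distrib]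
  exact Finset.sum_congr rfl fun _ _ => by ring

theorem stdSympF_add_left (p m : ℕ) (v v' w : Fin (2 * m) → ZMod p) :
    stdSympF p m (v + v') w = stdSympF p m v w + stdSympF p m v' w := by
  unfold stdSympF
  rw [← Finset.sum_add_distrib]
  exact Finset.sum_congr rfl fun _ _ => by simp only [Pi.add_apply]; ring

theorem stdSympF_smul_left (p m : ℕ) (c : ZMod p) (v w : Fin (2 * m) → ZMod p) :
    stdSympF p m (c • v) w = c * stdSympF p m v w := by
  unfold stdSympF
  rw [Finset.mul_sum]
  exact Finset.sum_congr rfl fun _ _ => by simp only [Pi.smul_apply, smul_eq_mul]; ring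

theorem stdSympF_single_even (p m : ℕ) (v : Fin (2 * m) → ZMod p) (i : Fin m) :
    stdSympF p m v (Pi.single ⟨2 * (i : ℕ), by omega⟩ 1) = -v ⟨2 * (i : ℕ) + 1, by omega⟩ := by
  unfold stdSympF
  rw [Finset.sum_eq_single i]
  · simp
  · intro j _ hj
    have h1 : (j : ℕ) ≠ i := fun h => hj (Fin.ext h)
    have h2 : 2 * (j : ℕ) + 1 ≠ 2 * i := by omega
    simp [h1, h2]
  · simp

theorem stdSympF_single_odd (p m : ℕ) (v : Fin (2 * m) → ZMod p) (i : Fin m) :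
    stdSympF p m v (Pi.single ⟨2 * (i : ℕ) + 1, by omega⟩ 1) = v ⟨2 * (i : ℕ), by omega⟩ := by
  unfold stdSympF
  rw [Finset.sum_eq_single i]
  · simp
  · intro j _ hj
    have h1 : (j : ℕ) ≠ i := fun h => hj (Fin.ext h)
    have h2 : 2 * (j : ℕ) ≠ 2 * i + 1 := by omega
    simp [h1, h2]
  · simp

theorem eq_zero_of_forall_stdSympF_eq_zero (p m : ℕ) (v : Fin (2 * m) → ZMod p)
    (h : ∀ w, stdSympF p m v w = 0) : v = 0 := by
  funext k
  obtain ⟨k, hk⟩ := k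
  obtain ⟨i, rfl | rfl⟩ := Nat.even_or_odd' k
  · exact (stdSympF_single_odd p m v ⟨i, by omega⟩).symm.trans (h _)
  · exact neg_eq_zero.mp ((stdSympF_single_even p m v ⟨i, by omega⟩).symm.trans (h _))

theorem prodSympF_swap (p nA nB : ℕ) (u w : (Fin (2 * nA) → ZMod p) × (Fin (2 * nB) → ZMod p)) :
    prodSympF p nA nB u w = -prodSympF p nA nB w u := by
  unfold prodSympF
  rw [stdSympF_swap p nA u.1, stdSympF_swap p nB u.2]
  ring

theorem prodSympF_add_left (p nA nB : ℕ)
    (u u' w : (Fin (2 * nA) → ZMod p) × (Fin (2 * nB) → ZMod p)) :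
    prodSympF p nA nB (u + u') w = prodSympF p nA nB u w + prodSympF p nA nB u' w := by
  simp only [prodSympF, Prod.fst_add, Prod.snd_add, stdSympF_add_left]
  ring

theorem prodSympF_smul_left (p nA nB : ℕ) (c : ZMod p)
    (u w : (Fin (2 * nA) → ZMod p) × (Fin (2 * nB) → ZMod p)) :
    prodSympF p nA nB (c • u) w = c * prodSympF p nA nB u w := by
  simp only [prodSympF, Prod.smul_fst, Prod.smul_snd, stdSympF_smul_left]
  ring

/-- The product symplectic form as a bilinear form. -/
def prodSympBilin (p nA nB : ℕ) :
    LinearMap.BilinForm (ZMod p) ((Fin (2 * nA) → ZMod p) × (Fin (2 * nB) → ZMod p)) :=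
  LinearMap.mk₂ (ZMod p) (prodSympF p nA nB) (prodSympF_add_left p nA nB)
    (prodSympF_smul_left p nA nB)
    (fun u w w' => by
      rw [prodSympF_swap, prodSympF_add_left, prodSympF_swap p nA nB u w,
        prodSympF_swap p nA nB u w']
      ring)
    (fun c u w => by
      rw [prodSympF_swap, prodSympF_smul_left, prodSympF_swap p nA nB u w, smul_eq_mul]
      ring)

theorem prodSympBilin_apply (p nA nB : ℕ)
    (u w : (Fin (2 * nA) → ZMod p) × (Fin (2 * nB) → ZMod p)) :
    prodSympBilin p nA nB u w = prodSympF p nA nB u w :=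
  rfl

theorem prodSympBilin_isAlt (p nA nB : ℕ) : (prodSympBilin p nA nB).IsAlt := fun u => by
  simp [prodSympBilin_apply, prodSympF, stdSympF_self]

theorem prodSympBilin_nondegenerate (p nA nB : ℕ) : (prodSympBilin p nA nB).Nondegenerate := by
  refine (prodSympBilin_isAlt p nA nB).isRefl.nondegenerate_iff_separatingLeft.mpr ?_
  intro u hu
  refine Prod.ext (eq_zero_of_forall_stdSympF_eq_zero p nA _ fun w => ?_)
    (eq_zero_of_forall_stdSympF_eq_zero p nB _ fun w => ?_)
  · simpa [prodSympBilin_apply, prodSympF, stdSympF_zero_right] using hu (w, 0)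
  · simpa [prodSympBilin_apply, prodSympF, stdSympF_zero_right] using hu (0, w)

/-- A Lagrangian subspace is its own symplectic complement. -/
theorem orthogonal_eq_self_of_lagrangian (p nA nB : ℕ) [Fact p.Prime]
    (L : Submodule (ZMod p) ((Fin (2 * nA) → ZMod p) × (Fin (2 * nB) → ZMod p)))
    (hiso : ∀ u ∈ L, ∀ w ∈ L, prodSympF p nA nB u w = 0)
    (hdim : Module.finrank (ZMod p) L = nA + nB) :
    (prodSympBilin p nA nB).orthogonal L = L := by
  symm
  apply Submodule.eq_of_le_of_finrank_eq
  · exact fun w hw u hu => hiso u hu w hw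
  · rw [LinearMap.BilinForm.finrank_orthogonal (prodSympBilin_nondegenerate p nA nB), hdim,
      Module.finrank_prod, Module.finrank_fin_fun, Module.finrank_fin_fun]
    omega

/-- For a Lagrangian subspace `L` of `(ZMod p)^(2nA) × (ZMod p)^(2nB)` (`p` prime), the
radical of `σ_A` restricted to the projection `π_A(L)` equals `L_A = {u : (u,0) ∈ L}`:
the center of the projection of the correlated stabilizer subgroup onto one party is
trivial. -/
theorem radical_of_projected_lagrangian_zmod (p nA nB : ℕ) [Fact p.Prime]
    (L : Submodule (ZMod p) ((Fin (2 * nA) → ZMod p) × (Fin (2 * nB) → ZMod p)))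
    (hiso : ∀ u ∈ L, ∀ w ∈ L, prodSympF p nA nB u w = 0)
    (hdim : Module.finrank (ZMod p) L = nA + nB) :
    {u : Fin (2 * nA) → ZMod p |
        u ∈ Submodule.map
          (LinearMap.fst (ZMod p) (Fin (2 * nA) → ZMod p) (Fin (2 * nB) → ZMod p)) L ∧
        ∀ w ∈ Submodule.map
          (LinearMap.fst (ZMod p) (Fin (2 * nA) → ZMod p) (Fin (2 * nB) → ZMod p)) L,
          stdSympF p nA u w = 0} =
      {u : Fin (2 * nA) → ZMod p | (u, (0 : Fin (2 * nB) → ZMod p)) ∈ L} := by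
  ext u
  simp only [Set.mem_ofPred_eq, Submodule.mem_map, LinearMap.fst_apply]
  constructor
  · rintro ⟨-, hu⟩
    rw [← orthogonal_eq_self_of_lagrangian p nA nB L hiso hdim]
    intro w hw
    change prodSympF p nA nB w (u, 0) = 0
    rw [prodSympF_swap]
    simp [prodSympF, stdSympF_zero_left, hu w.1 ⟨w, hw, rfl⟩]
  · intro hu
    refine ⟨⟨_, hu, rfl⟩, ?_⟩
    rintro _ ⟨w, hw, rfl⟩
    simpa [prodSympF, stdSympF_zero_left] using hiso _ hu w hw

end EntTrim
end
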